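/- arXiv:2007.08591 — 2 statements merged into one kernel-verified Lean document; each statement's English description precedes it below -/
import Mathlib

section
/- Let G^ε(v) = ε^{-d} C_d exp(−⟨v/ε⟩) and μ a probability measure on ℝ^d. Then every second partial derivative of log(μ*G^ε) satisfies |∂_i ∂_j log(μ*G^ε)(v)| ≤ 4/ε² for all v ∈ ℝ^d. -/
open MeasureTheory Real

noncomputable def jb {d : ℕ} (v : EuclideanSpace ℝ (Fin d)) : ℝ := Real.sqrt (1 + ‖v‖ ^ 2)

noncomputable def Cd (d : ℕ) : ℝ := (∫ v : EuclideanSpace ℝ (Fin d), Real.exp (-jb v))⁻¹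

/-- The exponential regularization kernel `G^ε(v) = ε^{-d} C_d exp(−⟨v/ε⟩)`. -/
noncomputable def Geps (d : ℕ) (ε : ℝ) (v : EuclideanSpace ℝ (Fin d)) : ℝ :=
  ε ^ (-(d : ℝ)) * Cd d * Real.exp (-jb (ε⁻¹ • v))

/-- The `i`-th partial derivative (in the `i`-th coordinate direction). -/
noncomputable def pderiv {d : ℕ} (i : Fin d) (h : EuclideanSpace ℝ (Fin d) → ℝ)
    (v : EuclideanSpace ℝ (Fin d)) : ℝ :=
  fderiv ℝ h v (EuclideanSpace.single i (1 : ℝ))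

section aux
variable {d : ℕ}

local notation "EE" => EuclideanSpace ℝ (Fin d)

noncomputable def sJ (a : ℝ) (v : EuclideanSpace ℝ (Fin d)) : ℝ := Real.sqrt (1 + a ^ 2 * ‖v‖ ^ 2)

noncomputable def kK (a : ℝ) (v : EuclideanSpace ℝ (Fin d)) : ℝ := Real.exp (-sJ a v)

noncomputable def sJ' (a : ℝ) (v : EuclideanSpace ℝ (Fin d)) : EuclideanSpace ℝ (Fin d) →L[ℝ] ℝ :=
  (a ^ 2 * (sJ a v)⁻¹) • innerSL ℝ v

noncomputable def sj (a : ℝ) (j : Fin d) (v : EuclideanSpace ℝ (Fin d)) : ℝ :=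
  (a ^ 2 * (sJ a v)⁻¹) * v j

noncomputable def sj' (a : ℝ) (j : Fin d) (v : EuclideanSpace ℝ (Fin d)) :
    EuclideanSpace ℝ (Fin d) →L[ℝ] ℝ :=
  (a ^ 2 * (sJ a v)⁻¹) • EuclideanSpace.proj j
    - (v j * a ^ 2 * ((sJ a v) ^ 2)⁻¹) • sJ' a v

noncomputable def kK' (a : ℝ) (v : EuclideanSpace ℝ (Fin d)) : EuclideanSpace ℝ (Fin d) →L[ℝ] ℝ :=
  (-kK a v) • sJ' a v

noncomputable def kj (a : ℝ) (j : Fin d) (v : EuclideanSpace ℝ (Fin d)) : ℝ :=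
  (-kK a v) * sj a j v

noncomputable def kj' (a : ℝ) (j : Fin d) (v : EuclideanSpace ℝ (Fin d)) :
    EuclideanSpace ℝ (Fin d) →L[ℝ] ℝ :=
  (-kK a v) • sj' a j v + sj a j v • (-kK' a v)

lemma sJ_ge_one (a : ℝ) (v : EE) : 1 ≤ sJ a v := by
  unfold sJ
  rw [Real.one_le_sqrt]
  have : 0 ≤ a ^ 2 * ‖v‖ ^ 2 := by positivity
  linarith

lemma sJ_pos (a : ℝ) (v : EE) : 0 < sJ a v := lt_of_lt_of_le one_pos (sJ_ge_one a v)

lemma le_sJ {a : ℝ} (v : EE) : a * ‖v‖ ≤ sJ a v := by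
  unfold sJ
  apply Real.le_sqrt_of_sq_le
  nlinarith

lemma kK_pos (a : ℝ) (v : EE) : 0 < kK a v := Real.exp_pos _

lemma kK_le_one (a : ℝ) (v : EE) : kK a v ≤ 1 := by
  unfold kK
  rw [Real.exp_le_one_iff]
  linarith [sJ_pos a v]

lemma hasFDerivAt_sJ (a : ℝ) (v : EE) : HasFDerivAt (sJ a) (sJ' a v) v := by
  have h1 : HasFDerivAt (fun w : EE => 1 + a ^ 2 * ‖w‖ ^ 2) (a ^ 2 • (2 • innerSL ℝ v)) v :=
    (((hasStrictFDerivAt_norm_sq v).hasFDerivAt).const_mul (a ^ 2)).const_add 1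
  have h0 : (1 + a ^ 2 * ‖v‖ ^ 2) ≠ 0 := by positivity
  have h2 := h1.sqrt h0
  refine h2.congr_fderiv ?_
  ext h
  have := sJ_pos a v
  simp only [sJ', sJ] at *
  simp
  field_simp

lemma hasFDerivAt_kK (a : ℝ) (v : EE) : HasFDerivAt (kK a) (kK' a v) v := by
  have h2 := (hasFDerivAt_sJ a v).neg.exp
  refine h2.congr_fderiv ?_
  ext h
  simp [kK', kK]

lemma hasFDerivAt_sj (a : ℝ) (j : Fin d) (v : EE) : HasFDerivAt (sj a j) (sj' a j v) v := by
  have h1 : HasFDerivAt (fun w => (sJ a w)⁻¹) (-(((sJ a v) ^ 2)⁻¹ • sJ' a v)) v := by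
    have := (hasDerivAt_inv (sJ_pos a v).ne').comp_hasFDerivAt v (hasFDerivAt_sJ a v)
    refine this.congr_fderiv ?_
    ext h; simp
  have h3 : HasFDerivAt (fun w : EE => w j) (EuclideanSpace.proj j : EE →L[ℝ] ℝ) v :=
    (EuclideanSpace.proj j : EE →L[ℝ] ℝ).hasFDerivAt
  have h2 := (h1.const_mul (a ^ 2)).mul h3
  refine h2.congr_fderiv ?_
  ext h
  simp [sj']
  ring

lemma hasFDerivAt_kj (a : ℝ) (j : Fin d) (v : EE) : HasFDerivAt (kj a j) (kj' a j v) v := 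
  (hasFDerivAt_kK a v).neg.mul (hasFDerivAt_sj a j v)

lemma cont_sJ (a : ℝ) : Continuous (sJ a : EE → ℝ) := by unfold sJ; fun_prop
lemma cont_kK (a : ℝ) : Continuous (kK a : EE → ℝ) := by
  have := cont_sJ (d := d) a
  unfold kK; fun_prop
lemma cont_sJinv (a : ℝ) : Continuous (fun v : EE => (sJ a v)⁻¹) :=
  (cont_sJ a).inv₀ fun v => (sJ_pos a v).ne'
lemma cont_sJ' (a : ℝ) : Continuous (sJ' a : EE → _) := by
  have := cont_sJinv (d := d) a
  unfold sJ'; fun_prop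
lemma cont_sj (a : ℝ) (j : Fin d) : Continuous (sj a j : EE → _) := by
  have := cont_sJinv (d := d) a
  unfold sj; fun_prop
lemma cont_sj' (a : ℝ) (j : Fin d) : Continuous (sj' a j : EE → _) := by
  have := cont_sJinv (d := d) a
  have := cont_sJ' (d := d) a
  unfold sj'; simp only [← inv_pow]; fun_prop
lemma cont_kK' (a : ℝ) : Continuous (kK' a : EE → _) := by
  have := cont_kK (d := d) a
  have := cont_sJ' (d := d) a
  unfold kK'; fun_prop
lemma cont_kj (a : ℝ) (j : Fin d) : Continuous (kj a j : EE → _) := by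
  have := cont_kK (d := d) a
  have := cont_sj (d := d) a j
  unfold kj; fun_prop
lemma cont_kj' (a : ℝ) (j : Fin d) : Continuous (kj' a j : EE → _) := by
  have := cont_kK (d := d) a
  have := cont_kK' (d := d) a
  have := cont_sj (d := d) a j
  have := cont_sj' (d := d) a j
  unfold kj'; fun_prop

lemma coef_bound {a : ℝ} (ha : 0 < a) (v : EE) : a ^ 2 * (sJ a v)⁻¹ * ‖v‖ ≤ a := by
  have h := le_sJ (a := a) v
  have hp := sJ_pos a v
  rw [mul_right_comm, ← div_eq_mul_inv, div_le_iff₀ hp]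
  nlinarith

lemma norm_sJ' {a : ℝ} (ha : 0 < a) (v : EE) : ‖sJ' a v‖ ≤ a := by
  have hp := sJ_pos a v
  unfold sJ'
  rw [norm_smul, innerSL_apply_norm, Real.norm_of_nonneg (by positivity)]
  exact coef_bound ha v

lemma norm_sj {a : ℝ} (ha : 0 < a) (j : Fin d) (v : EE) : ‖sj a j v‖ ≤ a := by
  have hp := sJ_pos a v
  unfold sj
  rw [norm_mul, Real.norm_of_nonneg (by positivity)]
  refine le_trans ?_ (coef_bound ha v)
  gcongr
  exact PiLp.norm_apply_le v j

lemma norm_proj_le (j : Fin d) : ‖(EuclideanSpace.proj j : EE →L[ℝ] ℝ)‖ ≤ 1 := by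
  refine ContinuousLinearMap.opNorm_le_bound _ zero_le_one fun v => ?_
  simpa using PiLp.norm_apply_le v j

lemma norm_sj' {a : ℝ} (ha : 0 < a) (j : Fin d) (v : EE) : ‖sj' a j v‖ ≤ 2 * a ^ 2 := by
  have hp := sJ_pos a v
  have hi : (sJ a v)⁻¹ ≤ 1 := inv_le_one_of_one_le₀ (sJ_ge_one a v)
  have hi0 : 0 ≤ (sJ a v)⁻¹ := by positivity
  have e : v j * a ^ 2 * ((sJ a v) ^ 2)⁻¹ = sj a j v * (sJ a v)⁻¹ := by
    unfold sj; field_simp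
  unfold sj'
  rw [e]
  refine (norm_sub_le _ _).trans ?_
  rw [norm_smul, norm_smul, norm_mul, norm_mul, Real.norm_of_nonneg hi0,
    Real.norm_of_nonneg (sq_nonneg a)]
  have h1 : a ^ 2 * (sJ a v)⁻¹ * ‖(EuclideanSpace.proj j : EE →L[ℝ] ℝ)‖ ≤ a ^ 2 * 1 * 1 := by
    gcongr
    exact norm_proj_le j
  have h2 : ‖sj a j v‖ * (sJ a v)⁻¹ * ‖sJ' a v‖ ≤ a * 1 * a := by
    gcongr
    · exact norm_sj ha j v
    · exact norm_sJ' ha v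
  linarith

lemma norm_kK' {a : ℝ} (ha : 0 < a) (v : EE) : ‖kK' a v‖ ≤ a * kK a v := by
  unfold kK'
  rw [norm_smul, norm_neg, Real.norm_of_nonneg (kK_pos a v).le, mul_comm]
  exact mul_le_mul_of_nonneg_right (norm_sJ' ha v) (kK_pos a v).le

lemma norm_kj {a : ℝ} (ha : 0 < a) (j : Fin d) (v : EE) : ‖kj a j v‖ ≤ a * kK a v := by
  unfold kj
  rw [norm_mul, norm_neg, Real.norm_of_nonneg (kK_pos a v).le, mul_comm]
  exact mul_le_mul_of_nonneg_right (norm_sj ha j v) (kK_pos a v).le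

lemma norm_kj' {a : ℝ} (ha : 0 < a) (j : Fin d) (v : EE) :
    ‖kj' a j v‖ ≤ 3 * a ^ 2 * kK a v := by
  unfold kj'
  have hk := kK_pos a v
  refine (norm_add_le _ _).trans ?_
  rw [norm_smul, norm_smul, norm_neg, norm_neg, Real.norm_of_nonneg hk.le]
  have h1 := mul_le_mul_of_nonneg_left (norm_sj' ha j v) hk.le
  have h2 := mul_le_mul (norm_sj ha j v) (norm_kK' ha v) (norm_nonneg _) ha.le
  nlinarith

lemma kK'_single (a : ℝ) (j : Fin d) (v : EE) :
    kK' a v (EuclideanSpace.single j (1 : ℝ)) = kj a j v := by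
  simp [kK', kj, sJ', sj, EuclideanSpace.inner_single_right]

lemma integrable_of_bdd {F : Type*} [NormedAddCommGroup F] [SecondCountableTopology F]
    (μ : Measure EE) [IsProbabilityMeasure μ] {φ : EE → F}
    (hφ : Continuous φ) {C : ℝ} (hC : ∀ v, ‖φ v‖ ≤ C) (w : EE) :
    Integrable (fun w' => φ (w - w')) μ := by
  refine Integrable.of_bound (C := C) ?_ (Filter.Eventually.of_forall fun x => hC _)
  exact (hφ.comp (continuous_const.sub continuous_id)).aestronglyMeasurable

lemma hasFDerivAt_conv (μ : Measure EE) [IsProbabilityMeasure μ] {φ : EE → ℝ}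
    {φ' : EE → EE →L[ℝ] ℝ} (hφ : ∀ v, HasFDerivAt φ (φ' v) v) (hc' : Continuous φ')
    {C C' : ℝ} (hC : ∀ v, ‖φ v‖ ≤ C) (hC' : ∀ v, ‖φ' v‖ ≤ C') (v : EE) :
    HasFDerivAt (fun w => ∫ w', φ (w - w') ∂μ) (∫ w', φ' (v - w') ∂μ) v := by
  have hc : Continuous φ := continuous_iff_continuousAt.2 fun v => (hφ v).continuousAt
  refine hasFDerivAt_integral_of_dominated_of_fderiv_le (s := Set.univ) (bound := fun _ => C')
    (F := fun w w' => φ (w - w')) (F' := fun w w' => φ' (w - w')) Filter.univ_mem ?_ ?_ ?_ ?_ ?_ ?_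
  · exact Filter.Eventually.of_forall fun w => (integrable_of_bdd μ hc hC w).aestronglyMeasurable
  · exact integrable_of_bdd μ hc hC v
  · exact (integrable_of_bdd μ hc' hC' v).aestronglyMeasurable
  · exact Filter.Eventually.of_forall fun x w _ => hC' _
  · exact integrable_const _
  · refine Filter.Eventually.of_forall fun x w _ => ?_
    have := (hφ (w - x)).comp w ((hasFDerivAt_id w).sub_const x)
    simpa [Function.comp_def] using this

lemma Geps_eq {ε : ℝ} (v : EE) :
    Geps d ε v = ε ^ (-(d : ℝ)) * Cd d * kK ε⁻¹ v := by
  unfold Geps kK jb sJ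
  rw [norm_smul, mul_pow, Real.norm_eq_abs, sq_abs]

end aux

/-- Second-order log-derivative bound: `|∂_i ∂_j log(μ*G^ε)| ≤ 4/ε²`. -/
theorem second_log_deriv_bound {d : ℕ} (ε : ℝ) (hε : 0 < ε)
    (μ : Measure (EuclideanSpace ℝ (Fin d))) [IsProbabilityMeasure μ]
    (i j : Fin d) (v : EuclideanSpace ℝ (Fin d)) :
    |pderiv i (pderiv j (fun w => Real.log (∫ w', Geps d ε (w - w') ∂μ))) v| ≤
      4 / ε ^ 2 := by
  set a := ε⁻¹ with hadef
  have ha : 0 < a := inv_pos.2 hε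
  set c := ε ^ (-(d : ℝ)) * Cd d with hcdef
  have e4 : 4 / ε ^ 2 = 4 * a ^ 2 := by rw [hadef, inv_pow, div_eq_mul_inv]
  rw [e4]
  have e0 : (fun w => Real.log (∫ w', Geps d ε (w - w') ∂μ))
      = fun w => Real.log (c * ∫ w', kK a (w - w') ∂μ) := by
    funext w
    simp_rw [Geps_eq]
    rw [integral_const_mul]
  rw [e0]
  by_cases hc : c = 0
  · have z1 : (fun w => Real.log (c * ∫ w', kK a (w - w') ∂μ)) = fun _ => 0 := by
      funext w; simp [hc]
    have z2 : pderiv j (fun _ : EuclideanSpace ℝ (Fin d) => (0 : ℝ)) = fun _ => 0 := by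
      funext w; simp [pderiv]
    rw [z1, z2]
    simp [pderiv]
    positivity
  have bK : ∀ v : EuclideanSpace ℝ (Fin d), ‖kK a v‖ ≤ 1 := fun v => by
    rw [Real.norm_of_nonneg (kK_pos a v).le]; exact kK_le_one a v
  have bK' : ∀ v : EuclideanSpace ℝ (Fin d), ‖kK' a v‖ ≤ a := fun v =>
    (norm_kK' ha v).trans (by nlinarith [kK_le_one a v])
  have bj : ∀ (j : Fin d) (v : EuclideanSpace ℝ (Fin d)), ‖kj a j v‖ ≤ a := fun j v =>
    (norm_kj ha j v).trans (by nlinarith [kK_le_one a v])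
  have bj' : ∀ v : EuclideanSpace ℝ (Fin d), ‖kj' a j v‖ ≤ 3 * a ^ 2 := fun v =>
    (norm_kj' ha j v).trans (by nlinarith [kK_le_one a v, sq_nonneg a])
  set F : EuclideanSpace ℝ (Fin d) → ℝ := fun w => ∫ w', kK a (w - w') ∂μ with hF
  set Fj : Fin d → EuclideanSpace ℝ (Fin d) → ℝ := fun j w => ∫ w', kj a j (w - w') ∂μ with hFj
  have iK : ∀ w, Integrable (fun w' => kK a (w - w')) μ := integrable_of_bdd μ (cont_kK a) bK
  have Fpos : ∀ w, 0 < F w := fun w => by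
    rw [hF]
    refine (integral_pos_iff_support_of_nonneg (fun x => (kK_pos a _).le) (iK w)).2 ?_
    have : Function.support (fun w' => kK a (w - w')) = Set.univ := by
      ext x; simp [(kK_pos a (w - x)).ne']
    rw [this]; simp
  have dF : ∀ w, HasFDerivAt F (∫ w', kK' a (w - w') ∂μ) w :=
    hasFDerivAt_conv μ (hasFDerivAt_kK a) (cont_kK' a) bK bK'
  have dFj : ∀ w, HasFDerivAt (Fj j) (∫ w', kj' a j (w - w') ∂μ) w :=
    hasFDerivAt_conv μ (hasFDerivAt_kj a j) (cont_kj' a j) (bj j) bj'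
  have sF : ∀ (j : Fin d) w, (∫ w', kK' a (w - w') ∂μ) (EuclideanSpace.single j (1 : ℝ)) = Fj j w := by
    intro j w
    rw [ContinuousLinearMap.integral_apply (integrable_of_bdd μ (cont_kK' a) bK' w)]
    simp_rw [kK'_single]
    rfl
  have bFj : ∀ (j : Fin d) w, |Fj j w| ≤ a * F w := by
    intro j w
    rw [hF, ← integral_const_mul]
    exact norm_integral_le_of_norm_le ((iK w).const_mul a)
      (Filter.Eventually.of_forall fun x => norm_kj ha j _)
  have bF2 : ∀ w, ‖∫ w', kj' a j (w - w') ∂μ‖ ≤ 3 * a ^ 2 * F w := by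
    intro w
    rw [hF, ← integral_const_mul]
    exact norm_integral_le_of_norm_le ((iK w).const_mul _)
      (Filter.Eventually.of_forall fun x => norm_kj' ha j _)
  have p1 : pderiv j (fun w => Real.log (c * F w)) = fun w => Fj j w * (F w)⁻¹ := by
    funext w
    have h := ((dF w).const_mul c).log (mul_ne_zero hc (Fpos w).ne')
    unfold pderiv
    rw [h.fderiv]
    have := (Fpos w).ne'
    simp only [_root_.smul_apply, sF, smul_eq_mul]
    field_simp
  have hinv : HasFDerivAt (fun w => (F w)⁻¹) (-(((F v) ^ 2)⁻¹ • ∫ w', kK' a (v - w') ∂μ)) v := by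
    have := (hasDerivAt_inv (Fpos v).ne').comp_hasFDerivAt v (dF v)
    refine this.congr_fderiv ?_
    ext h; simp
  have p2 := (dFj v).mul hinv
  rw [p1]
  unfold pderiv
  erw [p2.fderiv]
  set T := (∫ w', kj' a j (v - w') ∂μ) (EuclideanSpace.single i (1 : ℝ)) with hT
  have bT : |T| ≤ 3 * a ^ 2 * F v := by
    refine ((∫ w', kj' a j (v - w') ∂μ).le_opNorm (EuclideanSpace.single i (1 : ℝ))).trans ?_
    simpa using bF2 v
  simp only [_root_.add_apply, _root_.smul_apply, _root_.neg_apply, sF, smul_eq_mul, ← hT]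
  have hp := Fpos v
  have e5 : Fj j v * -((F v ^ 2)⁻¹ * Fj i v) + (F v)⁻¹ * T
      = T / F v - (Fj j v / F v) * (Fj i v / F v) := by
    field_simp
    ring
  rw [e5]
  have q1 : |T / F v| ≤ 3 * a ^ 2 := by
    rw [abs_div, abs_of_pos hp, div_le_iff₀ hp]; exact bT
  have q2 : ∀ k, |Fj k v / F v| ≤ a := fun k => by
    rw [abs_div, abs_of_pos hp, div_le_iff₀ hp]; exact bFj k v
  have q3 := mul_le_mul (q2 j) (q2 i) (abs_nonneg _) ha.le
  rw [← abs_mul] at q3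
  have q4 := abs_sub (T / F v) ((Fj j v / F v) * (Fj i v / F v))
  nlinarith
end

section
/- Fix ε > 0, γ ∈ [−4, −2], E > 0, and let μ be a probability measure on ℝ^d with ∫⟨v⟩² dμ ≤ E. Let G^ε(v) = ε^{-d}C_d exp(−⟨v/ε⟩) and define the grazing gradient of the regularized entropy first variation as T(v,v_*) = |v−v_*|^{1+γ/2} Π[v−v_*] (∇(G^ε * log(μ*G^ε))(v) − ∇(G^ε * log(μ*G^ε))(v_*)). Then |T(v,v_*)| ≤ C(ε) for all v ≠ v_*, where C(ε) ≤ max(2/ε, 4/ε²). -/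
open MeasureTheory Real
open scoped RealInnerProductSpace

/-- The projection `Π[z]u = u − (z·u/|z|²) z` onto `{z}ᗮ`. -/
noncomputable def projPerp {d : ℕ} (z u : EuclideanSpace ℝ (Fin d)) :
    EuclideanSpace ℝ (Fin d) :=
  u - (⟪z, u⟫ / ‖z‖ ^ 2) • z

/-- `J = ∇(G^ε * log(μ*G^ε))`. -/
noncomputable def Jeps {d : ℕ} (ε : ℝ) (μ : Measure (EuclideanSpace ℝ (Fin d)))
    (v : EuclideanSpace ℝ (Fin d)) : EuclideanSpace ℝ (Fin d) :=
  gradient (fun u => ∫ w, Geps d ε (u - w) *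
    Real.log (∫ w', Geps d ε (w - w') ∂μ)) v

theorem jb_le {d : ℕ} (x y : EuclideanSpace ℝ (Fin d)) : jb x ≤ jb y + ‖x - y‖ := by
  unfold jb
  have h1 : ‖x‖ ≤ ‖y‖ + ‖x - y‖ := by
    have := norm_add_le y (x - y)
    simpa using this
  have h2 : ‖y‖ ≤ Real.sqrt (1 + ‖y‖ ^ 2) := Real.le_sqrt_of_sq_le (by linarith)
  have h3 := Real.sq_sqrt (show (0:ℝ) ≤ 1 + ‖y‖ ^ 2 by positivity)
  rw [Real.sqrt_le_iff]
  refine ⟨by positivity, ?_⟩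
  have h4 : ‖x‖ ^ 2 ≤ (‖y‖ + ‖x - y‖) ^ 2 := by gcongr
  nlinarith [norm_nonneg (x - y)]

theorem norm_le_jb {d : ℕ} (x : EuclideanSpace ℝ (Fin d)) : ‖x‖ ≤ jb x :=
  Real.le_sqrt_of_sq_le (by linarith)

theorem jb_contDiff {d : ℕ} : ContDiff ℝ 1 (jb : EuclideanSpace ℝ (Fin d) → ℝ) := by
  unfold jb
  apply ContDiff.sqrt
  · exact contDiff_const.add (contDiff_norm_sq ℝ)
  · intro x
    positivity

theorem kernel_integrable (d : ℕ) (ε : ℝ) (hε : 0 < ε) :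
    Integrable (fun x : EuclideanSpace ℝ (Fin d) =>
      Real.exp (-jb (ε⁻¹ • x)) * (1 + ‖x‖)) := by
  have h0 : Integrable (fun x : EuclideanSpace ℝ (Fin d) => (1 + ‖x‖) ^ (-((d:ℝ) + 1))) := by
    apply integrable_one_add_norm
    simp
  refine (h0.const_mul (Real.exp (1/ε) * ((d+2).factorial * ε ^ (d+2)))).mono' ?_ ?_
  · have := (jb_contDiff (d := d)).continuous
    exact Continuous.aestronglyMeasurable (by fun_prop)
  · refine Filter.Eventually.of_forall fun x => ?_
    have hs : 0 < 1 + ‖x‖ := by positivity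
    rw [Real.norm_of_nonneg (by positivity)]
    have h1 : ‖x‖ / ε ≤ jb (ε⁻¹ • x) := by
      have := norm_le_jb (ε⁻¹ • x)
      rw [norm_smul, Real.norm_of_nonneg (by positivity)] at this
      rwa [div_eq_inv_mul]
    have h2 := Real.pow_div_factorial_le_exp (x := (1 + ‖x‖)/ε) (by positivity) (d+2)
    have h3 : Real.exp (-jb (ε⁻¹ • x)) ≤ Real.exp (1/ε) * Real.exp (-((1 + ‖x‖)/ε)) := by
      rw [← Real.exp_add]
      apply Real.exp_le_exp.2
      have : (1 + ‖x‖)/ε = 1/ε + ‖x‖/ε := by ring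
      linarith
    have h4 : Real.exp (-((1 + ‖x‖)/ε)) ≤ (d+2).factorial * ε ^ (d+2) / (1 + ‖x‖)^(d+2) := by
      rw [Real.exp_neg]
      refine (inv_anti₀ (by positivity) h2).trans (le_of_eq ?_)
      rw [div_pow]
      field_simp
    have h5 : (1 + ‖x‖) ^ (-((d:ℝ) + 1)) = ((1 + ‖x‖)^(d+1))⁻¹ := by
      rw [Real.rpow_neg hs.le]
      norm_cast
    rw [h5]
    calc _ ≤ Real.exp (1/ε) * ((d+2).factorial * ε ^ (d+2) / (1 + ‖x‖)^(d+2)) * (1 + ‖x‖) := by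
            gcongr
            exact h3.trans (by gcongr)
      _ = _ := by
            field_simp
            ring

theorem exp_jb_integrable (d : ℕ) (ε : ℝ) (hε : 0 < ε) :
    Integrable (fun x : EuclideanSpace ℝ (Fin d) => Real.exp (-jb (ε⁻¹ • x))) := by
  have := (jb_contDiff (d := d)).continuous
  refine (kernel_integrable d ε hε).mono' (Continuous.aestronglyMeasurable (by fun_prop)) ?_
  refine Filter.Eventually.of_forall fun x => ?_
  rw [Real.norm_of_nonneg (by positivity)]
  exact le_mul_of_one_le_right (by positivity) (by linarith [norm_nonneg x])

theorem exp_jb_pos (d : ℕ) : 0 < ∫ v : EuclideanSpace ℝ (Fin d), Real.exp (-jb v) := by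
  have h := exp_jb_integrable d 1 one_pos
  simp only [inv_one, one_smul] at h
  rw [integral_pos_iff_support_of_nonneg (fun x => by positivity) h]
  have : Function.support (fun v : EuclideanSpace ℝ (Fin d) => Real.exp (-jb v)) = Set.univ := by
    ext x
    simp [Real.exp_ne_zero]
  rw [this]
  exact (Measure.measure_univ_pos).2 (NeZero.ne _)

theorem Geps_pos {d : ℕ} {ε : ℝ} (hε : 0 < ε) (x : EuclideanSpace ℝ (Fin d)) :
    0 < Geps d ε x := by
  have := exp_jb_pos d
  unfold Geps Cd
  positivity

theorem Geps_contDiff {d : ℕ} (ε : ℝ) : ContDiff ℝ 1 (Geps d ε) := by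
  unfold Geps
  refine contDiff_const.mul (ContDiff.exp (ContDiff.neg (jb_contDiff.comp ?_)))
  exact contDiff_const_smul _

theorem Geps_integrable {d : ℕ} {ε : ℝ} (hε : 0 < ε) : Integrable (Geps d ε) :=
  (exp_jb_integrable d ε hε).const_mul _

theorem Geps_integrable' {d : ℕ} {ε : ℝ} (hε : 0 < ε) :
    Integrable (fun x => Geps d ε x * (1 + ‖x‖)) := by
  unfold Geps
  simp_rw [mul_assoc]
  exact ((kernel_integrable d ε hε).const_mul _).const_mul _

theorem Geps_integral {d : ℕ} {ε : ℝ} (hε : 0 < ε) : ∫ x, Geps d ε x = 1 := by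
  unfold Geps
  rw [integral_const_mul, Measure.integral_comp_smul volume (fun x => Real.exp (-jb x))]
  have := exp_jb_pos d
  unfold Cd
  rw [Real.rpow_neg hε.le, Real.rpow_natCast]
  simp only [finrank_euclideanSpace, Fintype.card_fin, smul_eq_mul]
  rw [abs_of_pos (by positivity)]
  field_simp
  rw [← mul_pow, mul_one_div_cancel hε.ne', one_pow]

theorem Geps_le {d : ℕ} {ε : ℝ} (hε : 0 < ε) (x y : EuclideanSpace ℝ (Fin d)) :
    Geps d ε x ≤ Real.exp (‖x - y‖ / ε) * Geps d ε y := by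
  have h := exp_jb_pos d
  have h1 := jb_le (ε⁻¹ • y) (ε⁻¹ • x)
  rw [← smul_sub, norm_smul, Real.norm_of_nonneg (by positivity), norm_sub_rev, ← div_eq_inv_mul] at h1
  have h2 : Real.exp (-jb (ε⁻¹ • x)) ≤ Real.exp (‖x - y‖ / ε) * Real.exp (-jb (ε⁻¹ • y)) := by
    rw [← Real.exp_add]
    apply Real.exp_le_exp.2
    linarith
  unfold Geps
  have h3 : 0 < ε ^ (-(d:ℝ)) * Cd d := by
    unfold Cd
    positivity
  calc _ ≤ ε ^ (-(d : ℝ)) * Cd d * (Real.exp (‖x - y‖ / ε) * Real.exp (-jb (ε⁻¹ • y))) := by gcongr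
    _ = _ := by ring

theorem Geps_sub_le {d : ℕ} {ε : ℝ} (hε : 0 < ε) (x y : EuclideanSpace ℝ (Fin d)) :
    |Geps d ε x - Geps d ε y| ≤ (Real.exp (‖x - y‖ / ε) - 1) * Geps d ε y := by
  have h1 := Geps_le hε x y
  have h2 := Geps_le hε y x
  rw [norm_sub_rev] at h2
  have hx := Geps_pos hε x
  have hy := Geps_pos hε y
  set e := Real.exp (‖x - y‖ / ε) with he
  have h3 : 1 ≤ e := Real.one_le_exp (by positivity)
  rw [abs_le]
  constructor
  · by_contra hc
    push Not at hc
    nlinarith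
  · linarith

theorem exp_small {t : ℝ} (h0 : 0 ≤ t) (h1 : t ≤ 1) : Real.exp t - 1 ≤ 2 * t := by
  have := Real.abs_exp_sub_one_le (x := t) (by rwa [abs_of_nonneg h0])
  rw [abs_of_nonneg h0] at this
  exact (le_abs_self _).trans this

theorem small_nhds {d : ℕ} {ε : ℝ} (hε : 0 < ε) (x : EuclideanSpace ℝ (Fin d)) :
    ∀ᶠ y in nhds x, Real.exp (‖y - x‖ / ε) - 1 ≤ 2 / ε * ‖y - x‖ := by
  filter_upwards [Metric.ball_mem_nhds x hε] with y hy
  rw [Metric.mem_ball, dist_eq_norm] at hy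
  refine (exp_small (by positivity) ((div_le_one hε).2 hy.le)).trans (le_of_eq ?_)
  ring

theorem Geps_fderiv {d : ℕ} {ε : ℝ} (hε : 0 < ε) (x : EuclideanSpace ℝ (Fin d)) :
    ‖fderiv ℝ (Geps d ε) x‖ ≤ 2 / ε * Geps d ε x := by
  have hx := Geps_pos hε x
  refine norm_fderiv_le_of_lip' ℝ (by positivity) ?_
  filter_upwards [small_nhds hε x] with y hy
  rw [Real.norm_eq_abs]
  refine (Geps_sub_le hε y x).trans ?_
  calc _ ≤ 2 / ε * ‖y - x‖ * Geps d ε x := by gcongr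
    _ = _ := by ring

theorem lip_cont {d : ℕ} {ε : ℝ} (hε : 0 < ε) {f : EuclideanSpace ℝ (Fin d) → ℝ}
    (hf : ∀ x y, |f x - f y| ≤ ‖x - y‖ / ε) : Continuous f := by
  have : LipschitzWith (Real.toNNReal ε⁻¹) f := by
    apply LipschitzWith.of_dist_le_mul
    intro x y
    rw [Real.dist_eq, dist_eq_norm, Real.coe_toNNReal _ (by positivity), ← div_eq_inv_mul]
    exact hf x y
  exact this.continuous

theorem conv_bound {d : ℕ} {ε : ℝ} (hε : 0 < ε) {f : EuclideanSpace ℝ (Fin d) → ℝ}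
    (hf : ∀ x y, |f x - f y| ≤ ‖x - y‖ / ε) (u w : EuclideanSpace ℝ (Fin d)) :
    Geps d ε (u - w) * |f w| ≤ (|f u| + 1/ε) * (Geps d ε (u - w) * (1 + ‖u - w‖)) := by
  have hg := Geps_pos hε (u - w)
  have h1 : |f w| ≤ (|f u| + 1/ε) * (1 + ‖u - w‖) := by
    have h2 := hf u w
    have h3 : |f w| ≤ |f u| + |f u - f w| := by
      have := abs_sub_abs_le_abs_sub (f w) (f u)
      rw [abs_sub_comm] at this
      linarith
    have h4 : 0 ≤ |f u| * ‖u - w‖ := by positivity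
    have h5 : 0 < 1/ε := by positivity
    have h6 : ‖u - w‖/ε = 1/ε * ‖u - w‖ := by ring
    nlinarith
  calc _ ≤ Geps d ε (u - w) * ((|f u| + 1/ε) * (1 + ‖u - w‖)) := by gcongr
    _ = _ := by ring

theorem conv_integrable {d : ℕ} {ε : ℝ} (hε : 0 < ε) {f : EuclideanSpace ℝ (Fin d) → ℝ}
    (hf : ∀ x y, |f x - f y| ≤ ‖x - y‖ / ε) (u : EuclideanSpace ℝ (Fin d)) :
    Integrable (fun w => Geps d ε (u - w) * f w) := by
  have h1 := (((Geps_integrable' (d := d) hε).comp_sub_left u).const_mul (|f u| + 1/ε))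
  have := lip_cont hε hf
  have := (Geps_contDiff (d := d) ε).continuous
  refine h1.mono' (Continuous.aestronglyMeasurable (by fun_prop)) ?_
  refine Filter.Eventually.of_forall fun w => ?_
  rw [Real.norm_eq_abs, abs_mul, abs_of_pos (Geps_pos hε _)]
  exact conv_bound hε hf u w

theorem conv_diff {d : ℕ} {ε : ℝ} (hε : 0 < ε) {f : EuclideanSpace ℝ (Fin d) → ℝ}
    (hf : ∀ x y, |f x - f y| ≤ ‖x - y‖ / ε) :
    Differentiable ℝ (fun u => ∫ w, Geps d ε (u - w) * f w) := by
  intro u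
  have hfc := lip_cont hε hf
  have hgc := (Geps_contDiff (d := d) ε).continuous
  have hgd : Differentiable ℝ (Geps d ε) := (Geps_contDiff (d := d) ε).differentiable (by norm_num)
  have hg' : Continuous (fderiv ℝ (Geps d ε)) := (Geps_contDiff (d := d) ε).continuous_fderiv (by norm_num)
  refine (hasFDerivAt_integral_of_dominated_of_fderiv_le (𝕜 := ℝ)
    (F := fun u w => Geps d ε (u - w) * f w)
    (F' := fun u w => f w • fderiv ℝ (Geps d ε) (u - w))
    (bound := fun w => 2 / ε * Real.exp 1 * ((|f u| + 1/ε) * (Geps d ε (u - w) * (1 + ‖u - w‖))))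
    (Metric.ball_mem_nhds u hε) ?_ (conv_integrable hε hf u) ?_ ?_ ?_ ?_).differentiableAt
  · exact Filter.Eventually.of_forall fun x => (conv_integrable hε hf x).aestronglyMeasurable
  · exact Continuous.aestronglyMeasurable (by fun_prop)
  · refine Filter.Eventually.of_forall fun w x hx => ?_
    rw [Metric.mem_ball, dist_eq_norm] at hx
    rw [norm_smul, Real.norm_eq_abs]
    have h1 := Geps_fderiv hε (x - w)
    have h2 := Geps_le hε (x - w) (u - w)
    rw [sub_sub_sub_cancel_right] at h2
    have h3 : Real.exp (‖x - u‖ / ε) ≤ Real.exp 1 :=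
      Real.exp_le_exp.2 ((div_le_one hε).2 hx.le)
    have hg := Geps_pos hε (u - w)
    calc _ ≤ |f w| * (2 / ε * (Real.exp 1 * Geps d ε (u - w))) := by
            gcongr
            refine h1.trans ?_
            gcongr
            exact h2.trans (by gcongr)
      _ = 2 / ε * Real.exp 1 * (Geps d ε (u - w) * |f w|) := by ring
      _ ≤ _ := by
            gcongr ?_ * ?_
            exact conv_bound hε hf u w
  · exact (((Geps_integrable' (d := d) hε).comp_sub_left u).const_mul _).const_mul _
  · refine Filter.Eventually.of_forall fun w x _ => ?_
    have h1 : HasFDerivAt (fun x => Geps d ε (x - w)) (fderiv ℝ (Geps d ε) (x - w)) x := by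
      exact (hgd (x - w)).hasFDerivAt.comp x ((hasFDerivAt_id x).sub_const w)
    exact h1.mul_const (f w)

theorem lip_shift {d : ℕ} {ε : ℝ} {f : EuclideanSpace ℝ (Fin d) → ℝ}
    (hf : ∀ x y, |f x - f y| ≤ ‖x - y‖ / ε) (h : EuclideanSpace ℝ (Fin d)) :
    ∀ x y, |f (x + h) - f (y + h)| ≤ ‖x - y‖ / ε := by
  intro x y
  simpa using hf (x + h) (y + h)

theorem conv_shift {d : ℕ} {ε : ℝ} (f : EuclideanSpace ℝ (Fin d) → ℝ)
    (u h : EuclideanSpace ℝ (Fin d)) :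
    ∫ w, Geps d ε (u + h - w) * f w = ∫ w, Geps d ε (u - w) * f (w + h) := by
  rw [← integral_add_right_eq_self _ h]
  simp only [add_sub_add_right_eq_sub]

theorem Geps_integral_left {d : ℕ} {ε : ℝ} (hε : 0 < ε) (u : EuclideanSpace ℝ (Fin d)) :
    ∫ x, Geps d ε (u - x) = 1 := by
  rw [integral_sub_left_eq_self (fun x => Geps d ε x), Geps_integral hε]

theorem conv_lip {d : ℕ} {ε : ℝ} (hε : 0 < ε) {f : EuclideanSpace ℝ (Fin d) → ℝ}
    (hf : ∀ x y, |f x - f y| ≤ ‖x - y‖ / ε) (u h : EuclideanSpace ℝ (Fin d)) :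
    |(∫ w, Geps d ε (u + h - w) * f w) - ∫ w, Geps d ε (u - w) * f w| ≤ ‖h‖ / ε := by
  rw [conv_shift, ← integral_sub (conv_integrable hε (lip_shift hf h) u) (conv_integrable hε hf u),
    ← Real.norm_eq_abs]
  refine (norm_integral_le_of_norm_le
    (((Geps_integrable (d := d) hε).comp_sub_left u).mul_const (‖h‖ / ε)) ?_).trans ?_
  · refine Filter.Eventually.of_forall fun w => ?_
    rw [← mul_sub, Real.norm_eq_abs, abs_mul, abs_of_pos (Geps_pos hε _)]
    have := Geps_pos hε (u - w)
    gcongr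
    simpa using hf (w + h) w
  · rw [integral_mul_const, Geps_integral_left hε, one_mul]

theorem conv_lip2 {d : ℕ} {ε : ℝ} (hε : 0 < ε) {f : EuclideanSpace ℝ (Fin d) → ℝ}
    (hf : ∀ x y, |f x - f y| ≤ ‖x - y‖ / ε) (u u' h : EuclideanSpace ℝ (Fin d)) :
    |((∫ w, Geps d ε (u' + h - w) * f w) - ∫ w, Geps d ε (u' - w) * f w) -
      ((∫ w, Geps d ε (u + h - w) * f w) - ∫ w, Geps d ε (u - w) * f w)|
      ≤ (Real.exp (‖u' - u‖ / ε) - 1) * (‖h‖ / ε) := by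
  have hi := fun u => conv_integrable hε (lip_shift hf h) u
  have hj := fun u => conv_integrable hε hf u
  have hk : ∀ u, Integrable (fun w => Geps d ε (u - w) * f (w + h) - Geps d ε (u - w) * f w) :=
    fun u => (hi u).sub (hj u)
  rw [conv_shift, conv_shift, ← integral_sub (hi u') (hj u'), ← integral_sub (hi u) (hj u),
    ← integral_sub (hk u') (hk u), ← Real.norm_eq_abs]
  refine (norm_integral_le_of_norm_le
    (((Geps_integrable (d := d) hε).comp_sub_left u).mul_const
      ((Real.exp (‖u' - u‖ / ε) - 1) * (‖h‖ / ε))) ?_).trans ?_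
  · refine Filter.Eventually.of_forall fun w => ?_
    have e : Geps d ε (u' - w) * f (w + h) - Geps d ε (u' - w) * f w -
      (Geps d ε (u - w) * f (w + h) - Geps d ε (u - w) * f w) =
      (Geps d ε (u' - w) - Geps d ε (u - w)) * (f (w + h) - f w) := by ring
    rw [e, Real.norm_eq_abs, abs_mul]
    have h1 := Geps_sub_le hε (u' - w) (u - w)
    rw [sub_sub_sub_cancel_right] at h1
    have h2 : |f (w + h) - f w| ≤ ‖h‖ / ε := by simpa using hf (w + h) w
    calc _ ≤ _ := mul_le_mul h1 h2 (abs_nonneg _) ((abs_nonneg _).trans h1)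
      _ = _ := by ring
  · rw [integral_mul_const, Geps_integral_left hε, one_mul]

theorem log_lip {d : ℕ} {ε : ℝ} (hε : 0 < ε) (μ : Measure (EuclideanSpace ℝ (Fin d)))
    [IsProbabilityMeasure μ] (x y : EuclideanSpace ℝ (Fin d)) :
    |Real.log (∫ w', Geps d ε (x - w') ∂μ) - Real.log (∫ w', Geps d ε (y - w') ∂μ)|
      ≤ ‖x - y‖ / ε := by
  have hgc := (Geps_contDiff (d := d) ε).continuous
  have hint : ∀ x, Integrable (fun w' => Geps d ε (x - w')) μ := by
    intro x
    refine (integrable_const (ε ^ (-(d : ℝ)) * Cd d)).mono'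
      (Continuous.aestronglyMeasurable (by fun_prop)) ?_
    refine Filter.Eventually.of_forall fun w => ?_
    rw [Real.norm_of_nonneg (Geps_pos hε _).le]
    have h := exp_jb_pos d
    have h3 : 0 < ε ^ (-(d:ℝ)) * Cd d := by
      unfold Cd
      positivity
    unfold Geps
    refine mul_le_of_le_one_right h3.le (Real.exp_le_one_iff.2 ?_)
    unfold jb
    simp
  have hpos : ∀ x, 0 < ∫ w', Geps d ε (x - w') ∂μ := by
    intro x
    rw [integral_pos_iff_support_of_nonneg (fun w => (Geps_pos hε _).le) (hint x)]
    have : Function.support (fun w' => Geps d ε (x - w')) = Set.univ := by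
      ext w
      simp [(Geps_pos hε (x - w)).ne']
    rw [this]
    simp
  have key : ∀ x y, Real.log (∫ w', Geps d ε (x - w') ∂μ) ≤
      ‖x - y‖ / ε + Real.log (∫ w', Geps d ε (y - w') ∂μ) := by
    intro x y
    have h1 : ∫ w', Geps d ε (x - w') ∂μ ≤
        Real.exp (‖x - y‖ / ε) * ∫ w', Geps d ε (y - w') ∂μ := by
      rw [← integral_const_mul]
      refine integral_mono (hint x) ((hint y).const_mul _) fun w => ?_
      simpa using Geps_le hε (x - w) (y - w)
    have h2 := Real.log_le_log (hpos x) h1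
    rwa [Real.log_mul (Real.exp_ne_zero _) (hpos y).ne', Real.log_exp] at h2
  have h1 := key x y
  have h2 := key y x
  rw [norm_sub_rev] at h2
  rw [abs_le]
  constructor <;> linarith

theorem norm_projPerp_le {d : ℕ} (z u : EuclideanSpace ℝ (Fin d)) (hz : z ≠ 0) :
    ‖projPerp z u‖ ≤ ‖u‖ := by
  have hz' : ‖z‖ ≠ 0 := norm_ne_zero_iff.2 hz
  unfold projPerp
  refine le_of_sq_le_sq ?_ (norm_nonneg _)
  rw [norm_sub_sq_real, inner_smul_right, norm_smul, Real.norm_eq_abs, mul_pow, sq_abs,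
    real_inner_comm z u]
  have e : ‖u‖ ^ 2 - 2 * (⟪z, u⟫ / ‖z‖ ^ 2 * ⟪z, u⟫) + (⟪z, u⟫ / ‖z‖ ^ 2) ^ 2 * ‖z‖ ^ 2
    = ‖u‖ ^ 2 - ⟪z, u⟫ ^ 2 / ‖z‖ ^ 2 := by
    field_simp
    ring
  have : 0 ≤ ⟪z, u⟫ ^ 2 / ‖z‖ ^ 2 := by positivity
  linarith

theorem Jeps_norm {d : ℕ} {ε : ℝ} (hε : 0 < ε) (μ : Measure (EuclideanSpace ℝ (Fin d)))
    [IsProbabilityMeasure μ] (v : EuclideanSpace ℝ (Fin d)) : ‖Jeps ε μ v‖ ≤ 1 / ε := by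
  unfold Jeps gradient
  rw [LinearIsometryEquiv.norm_map]
  refine norm_fderiv_le_of_lip' ℝ (by positivity) (Filter.Eventually.of_forall fun x => ?_)
  have := conv_lip hε (log_lip hε μ) v (x - v)
  rw [add_sub_cancel] at this
  rw [Real.norm_eq_abs]
  refine this.trans (le_of_eq (by ring))

theorem Jeps_sub_norm {d : ℕ} {ε : ℝ} (hε : 0 < ε) (μ : Measure (EuclideanSpace ℝ (Fin d)))
    [IsProbabilityMeasure μ] (v vs : EuclideanSpace ℝ (Fin d)) :
    ‖Jeps ε μ v - Jeps ε μ vs‖ ≤ 4 / ε ^ 2 * ‖v - vs‖ := by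
  unfold Jeps gradient
  rw [← map_sub, LinearIsometryEquiv.norm_map]
  have hd := conv_diff hε (log_lip hε μ)
  have h2 := conv_lip2 hε (log_lip hε μ) vs
  set F := fun u => ∫ w, Geps d ε (u - w) *
    Real.log (∫ w', Geps d ε (w - w') ∂μ) with hF
  have e : fderiv ℝ F v - fderiv ℝ F vs = fderiv ℝ (fun u => F (u + (v - vs)) - F u) vs := by
    have h3 : DifferentiableAt ℝ (fun u => F (u + (v - vs))) vs :=
      (hd _).comp vs (differentiableAt_id.add_const _)
    rw [fderiv_fun_sub h3 (hd _), fderiv_comp_add_right]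
    simp
  rw [e]
  refine norm_fderiv_le_of_lip' ℝ (by positivity) ?_
  filter_upwards [small_nhds hε vs] with y hy
  rw [Real.norm_eq_abs]
  refine (h2 y (v - vs)).trans ?_
  calc _ ≤ 2 / ε * ‖y - vs‖ * (‖v - vs‖ / ε) := by gcongr
    _ = 2 / ε ^ 2 * ‖v - vs‖ * ‖y - vs‖ := by field_simp
    _ ≤ _ := by gcongr; norm_num

/-- Very soft potentials `γ ∈ [−4,−2]`: the grazing gradient of the regularized
entropy's first variation is uniformly bounded by `max(2/ε, 4/ε²)`. -/
theorem grazing_gradient_bound_very_soft {d : ℕ} (ε γ E : ℝ) (hε : 0 < ε)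
    (hγ₁ : -4 ≤ γ) (hγ₂ : γ ≤ -2) (hE : 0 < E)
    (μ : Measure (EuclideanSpace ℝ (Fin d))) [IsProbabilityMeasure μ]
    (hmom : ∫ v, jb v ^ 2 ∂μ ≤ E) :
    ∀ v vs : EuclideanSpace ℝ (Fin d), v ≠ vs →
      ‖(‖v - vs‖ ^ (1 + γ / 2)) •
          projPerp (v - vs) (Jeps ε μ v - Jeps ε μ vs)‖ ≤
        max (2 / ε) (4 / ε ^ 2) := by
  intro v vs hne
  have hz : v - vs ≠ 0 := sub_ne_zero.2 hne
  have hn : 0 < ‖v - vs‖ := norm_pos_iff.2 hz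
  have hp := norm_projPerp_le (v - vs) (Jeps ε μ v - Jeps ε μ vs) hz
  rw [norm_smul, Real.norm_of_nonneg (by positivity)]
  rcases le_total 1 ‖v - vs‖ with h | h
  · refine le_max_of_le_left ?_
    have h1 : ‖v - vs‖ ^ (1 + γ / 2) ≤ 1 :=
      Real.rpow_le_one_of_one_le_of_nonpos h (by linarith)
    have h2 := (norm_sub_le (Jeps ε μ v) (Jeps ε μ vs)).trans
      (add_le_add (Jeps_norm hε μ v) (Jeps_norm hε μ vs))
    calc _ ≤ 1 * (1 / ε + 1 / ε) := by
            gcongr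
            exact hp.trans h2
      _ = 2 / ε := by ring
  · refine le_max_of_le_right ?_
    have h1 : ‖v - vs‖ ^ (1 + γ / 2) ≤ ‖v - vs‖ ^ (-1 : ℝ) :=
      Real.rpow_le_rpow_of_exponent_ge hn h (by linarith)
    rw [Real.rpow_neg_one] at h1
    calc _ ≤ ‖v - vs‖⁻¹ * (4 / ε ^ 2 * ‖v - vs‖) := by
            gcongr
            exact hp.trans (Jeps_sub_norm hε μ v vs)
      _ = 4 / ε ^ 2 := by field_simp
end
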